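/- For every natural number m, let a_{n,2m} denote the 2m-th Taylor coefficient at 0 of the entire function z ↦ (sin(πz/2))^{2n}. Then the series Σ_{n=0}^∞ a_{n,2m} converges and Σ_{n=0}^∞ a_{n,2m} = (−1)^m (8m + 4)(2^{2m+2} − 1) B_{2m+2} π^{2m} / (2m+2)!, where B_k denotes the k-th Bernoulli number. -/

import Mathlib

open Complex Real

/-- The formal Taylor series of `f` at `0`. -/
noncomputable def taylorSeriesZero (f : ℂ → ℂ) : PowerSeries ℂ :=
  .mk fun n => iteratedDeriv n f 0 / (n.factorial : ℂ)

lemma taylorSeriesZero_mul {f g : ℂ → ℂ} (hf : ContDiff ℂ ⊤ f) (hg : ContDiff ℂ ⊤ g) :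
    taylorSeriesZero (fun z => f z * g z) = taylorSeriesZero f * taylorSeriesZero g := by
  ext n
  rw [PowerSeries.coeff_mul, taylorSeriesZero, PowerSeries.coeff_mk]
  have h := iteratedDeriv_mul (n := n) (x := 0) (hf.of_le le_top).contDiffAt
    (hg.of_le le_top).contDiffAt
  rw [show (fun z => f z * g z) = f * g from rfl, h,
    Finset.Nat.sum_antidiagonal_eq_sum_range_succ_mk, Finset.sum_div]
  refine Finset.sum_congr rfl fun i hi => ?_
  have hi : i ≤ n := by simpa [Nat.lt_succ_iff] using hi
  simp only [taylorSeriesZero, PowerSeries.coeff_mk]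
  rw [Nat.cast_choose ℂ hi]
  have h1 : (n.factorial : ℂ) ≠ 0 := by exact_mod_cast n.factorial_ne_zero
  field_simp

lemma taylorSeriesZero_pow {f : ℂ → ℂ} (hf : ContDiff ℂ ⊤ f) (n : ℕ) :
    taylorSeriesZero (fun z => f z ^ n) = taylorSeriesZero f ^ n := by
  induction n with
  | zero =>
    ext k
    rcases k with _ | k <;> simp [taylorSeriesZero, iteratedDeriv_const, PowerSeries.coeff_one]
  | succ n ih => simp_rw [pow_succ, taylorSeriesZero_mul (hf.pow n) hf, ih]

lemma taylorSeriesZero_exp (c : ℂ) :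
    taylorSeriesZero (fun z => Complex.exp (c * z)) =
      PowerSeries.rescale c (PowerSeries.exp ℂ) := by
  ext n
  simp [taylorSeriesZero, iteratedDeriv_cexp_const_mul, div_eq_mul_inv, PowerSeries.coeff_exp]

lemma sin_pi_mul_div_two_sq (z : ℂ) : Complex.sin (Real.pi * z / 2) ^ 2 =
    (1 / 4) * (2 - Complex.exp (Complex.I * Real.pi * z)
      - Complex.exp (-(Complex.I * Real.pi) * z)) := by
  have h : Complex.cos (2 * (Real.pi * z / 2)) = 1 - 2 * Complex.sin (Real.pi * z / 2) ^ 2 := by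
    rw [Complex.cos_two_mul, Complex.cos_sq']
    ring
  rw [Complex.cos, show 2 * (Real.pi * z / 2) * Complex.I = Complex.I * Real.pi * z by ring,
    show -(2 * (Real.pi * z / 2)) * Complex.I = -(Complex.I * Real.pi) * z by ring] at h
  linear_combination h / 2

lemma taylorSeriesZero_sin_sq :
    taylorSeriesZero (fun z => Complex.sin (Real.pi * z / 2) ^ 2) =
      PowerSeries.C (1 / 4 : ℂ) * (2 - PowerSeries.rescale (Complex.I * Real.pi) (PowerSeries.exp ℂ)
        - PowerSeries.rescale (-(Complex.I * Real.pi)) (PowerSeries.exp ℂ)) := by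
  rw [← taylorSeriesZero_exp, ← taylorSeriesZero_exp]
  simp_rw [sin_pi_mul_div_two_sq]
  have he (c : ℂ) (n : ℕ) : ContDiffAt ℂ n (fun z : ℂ => Complex.exp (c * z)) 0 := by fun_prop
  ext n
  simp only [taylorSeriesZero, PowerSeries.coeff_mk, PowerSeries.coeff_C_mul, map_sub]
  rw [iteratedDeriv_const_mul_field,
    iteratedDeriv_fun_sub (contDiffAt_const.sub (he _ n)) (he _ n),
    iteratedDeriv_fun_sub contDiffAt_const (he _ n), iteratedDeriv_const,
    ← map_ofNat (PowerSeries.C (R := ℂ)) 2, PowerSeries.coeff_C]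
  rcases n with _ | n
  · simp
  · simp only [Nat.add_eq_zero_iff, one_ne_zero, and_false, if_false]
    ring

/-- The series `1 / (exp X + 1)`. -/
noncomputable def invExpAddOne : PowerSeries ℂ :=
  .mk fun k => (1 - 2 ^ (k + 1)) * (bernoulli (k + 1) : ℂ) / ((k + 1).factorial : ℂ)

lemma invExpAddOne_mul : invExpAddOne * (PowerSeries.exp ℂ + 1) = 1 := by
  have hX : (PowerSeries.X : PowerSeries ℂ) * invExpAddOne =
      bernoulliPowerSeries ℂ - PowerSeries.rescale 2 (bernoulliPowerSeries ℂ) := by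
    ext k
    rcases k with _ | k
    · rw [PowerSeries.coeff_zero_X_mul, map_sub, PowerSeries.coeff_rescale, pow_zero, one_mul,
        sub_self]
    · rw [PowerSeries.coeff_succ_X_mul]
      simp only [bernoulliPowerSeries, invExpAddOne, PowerSeries.coeff_mk, map_sub,
        PowerSeries.coeff_rescale, eq_ratCast, Rat.cast_div, Rat.cast_natCast]
      ring
  have h1 := bernoulliPowerSeries_mul_exp_sub_one ℂ
  have h2 := congrArg (PowerSeries.rescale (2 : ℂ)) h1
  have h3 := PowerSeries.exp_pow_eq_rescale_exp (A := ℂ) 2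
  have hne : PowerSeries.exp ℂ - 1 ≠ 0 := by
    intro h
    rw [h, mul_zero] at h1
    exact PowerSeries.X_ne_zero h1.symm
  push_cast at h3
  rw [map_mul, map_sub, map_one, PowerSeries.rescale_X, ← h3, map_ofNat] at h2
  refine mul_left_cancel₀ (mul_ne_zero PowerSeries.X_ne_zero hne) ?_
  linear_combination (PowerSeries.exp ℂ ^ 2 - 1) * hX + (PowerSeries.exp ℂ + 1) * h1 - h2

lemma derivative_invExpAddOne_mul :
    PowerSeries.derivative ℂ invExpAddOne * (PowerSeries.exp ℂ + 1) ^ 2 = - PowerSeries.exp ℂ := by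
  have h := congrArg (PowerSeries.derivative ℂ) invExpAddOne_mul
  simp only [Derivation.leibniz, map_add, smul_eq_mul, PowerSeries.derivative_exp,
    Derivation.map_one_eq_zero, add_zero] at h
  linear_combination (PowerSeries.exp ℂ + 1) * h - PowerSeries.exp ℂ * invExpAddOne_mul

lemma hasSum_coeff_pow {D s : PowerSeries ℂ} (hs : PowerSeries.constantCoeff s = 0)
    (hD : D * (1 - s) = 1) (N : ℕ) :
    HasSum (fun n => PowerSeries.coeff N (s ^ n)) (PowerSeries.coeff N D) := by
  have hz : ∀ (n : ℕ) (g : PowerSeries ℂ), N < n → PowerSeries.coeff N (g * s ^ n) = 0 :=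
    fun n g hn =>
      PowerSeries.X_pow_dvd_iff.1 ((pow_dvd_pow_of_dvd (PowerSeries.X_dvd_iff.2 hs) n).mul_left g)
        N hn
  have h : D = ∑ n ∈ Finset.range (N + 1), s ^ n + D * s ^ (N + 1) := by
    linear_combination (∑ n ∈ Finset.range (N + 1), s ^ n) * hD - D * geom_sum_mul_neg s (N + 1)
  rw [h, map_add, hz _ _ N.lt_succ_self, add_zero, map_sum]
  refine hasSum_sum_of_ne_finset_zero fun n hn => ?_
  simpa using hz n 1 (by simpa using hn)

theorem sonnenschein_sin_column_sum (m : ℕ) :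
    HasSum
      (fun n : ℕ =>
        iteratedDeriv (2 * m) (fun z : ℂ => Complex.sin (Real.pi * z / 2) ^ (2 * n)) 0
          / ((2 * m).factorial : ℂ))
      ((-1 : ℂ) ^ m * (8 * m + 4) * (2 ^ (2 * m + 2) - 1) * (bernoulli (2 * m + 2) : ℂ)
        * (Real.pi : ℂ) ^ (2 * m) / ((2 * m + 2).factorial : ℂ)) := by
  set a : ℂ := Complex.I * Real.pi with ha
  set s := taylorSeriesZero (fun z => Complex.sin (Real.pi * z / 2) ^ 2) with hs
  have hs0 : PowerSeries.constantCoeff s = 0 := by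
    simp [hs, taylorSeriesZero, ← PowerSeries.coeff_zero_eq_constantCoeff_apply]
  have hD : PowerSeries.rescale a (-4 * PowerSeries.derivative ℂ invExpAddOne) * (1 - s) = 1 := by
    have h := congrArg (PowerSeries.rescale a) derivative_invExpAddOne_mul
    have hE := PowerSeries.exp_mul_exp_eq_exp_add a (-a)
    have h4 : (PowerSeries.C (1 / 4 : ℂ)) * 4 = 1 := by
      rw [← map_ofNat (PowerSeries.C (R := ℂ)) 4, ← map_mul]; simp
    simp only [add_neg_cancel, PowerSeries.rescale_zero, RingHom.comp_apply,
      PowerSeries.constantCoeff_exp, map_one] at hE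
    rw [hs, taylorSeriesZero_sin_sq, ← ha]
    simp only [map_mul, map_neg, map_ofNat, map_pow, map_add, map_one] at h ⊢
    set E := PowerSeries.rescale a (PowerSeries.exp ℂ)
    set E' := PowerSeries.rescale (-a) (PowerSeries.exp ℂ)
    set D := PowerSeries.rescale a (PowerSeries.derivative ℂ invExpAddOne)
    set c := PowerSeries.C (1 / 4 : ℂ)
    linear_combination D * (2 - E - E') * h4 - E' * h + (1 + D * E + 2 * D) * hE
  convert hasSum_coeff_pow hs0 hD (2 * m) using 1
  · funext n
    rw [hs, ← taylorSeriesZero_pow (by fun_prop)]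
    simp [taylorSeriesZero, pow_mul]
  · rw [PowerSeries.coeff_rescale, neg_mul, map_neg, ← map_ofNat (PowerSeries.C (R := ℂ)) 4,
      PowerSeries.coeff_C_mul, PowerSeries.coeff_derivative, ha, mul_pow,
      pow_mul Complex.I, Complex.I_sq]
    simp only [invExpAddOne, PowerSeries.coeff_mk]
    push_cast
    ring
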